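/- Suppose all entries of A are real, v̄ₖ is real, and x̄ ∈ ℂⁿ has all real coordinates. Suppose r > 0 is such that there is exactly one x in the closed ball B̄(x̄, r) with f(x) = 0. Then this x has all real coordinates; in particular λ(x) ∈ ℝ and every component of v(x) is real. -/

import Mathlib

noncomputable section

open Matrix Finset

/-- The index `0` of `Fin n` (well-defined since `Fin n` is inhabited by `k`). -/
def i0 {n : ℕ} (k : Fin n) : Fin n := ⟨0, Nat.lt_of_le_of_lt (Nat.zero_le _) k.isLt⟩

/-- The vector `v(x)`: `k`-th component is `vk`, remaining components in order are
`x 1, …, x (n-1)`. -/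
def vV {n : ℕ} (k : Fin n) (vk : ℂ) (x : Fin n → ℂ) : Fin n → ℂ :=
  fun j => if j = k then vk
    else if h : (j : ℕ) < (k : ℕ) then x ⟨(j : ℕ) + 1, by have := k.isLt; omega⟩ else x j

/-- The vector `ṽ(x)`: `k`-th component is `0`, remaining components in order are
`x 1, …, x (n-1)`. -/
def vT {n : ℕ} (k : Fin n) (x : Fin n → ℂ) : Fin n → ℂ := vV k 0 x

/-- `f(x) = A v(x) - λ(x) v(x)` where `λ(x) = x 0`. -/
def fE {n : ℕ} (A : Matrix (Fin n) (Fin n) ℂ) (k : Fin n) (vk : ℂ) (x : Fin n → ℂ) : Fin n → ℂ :=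
  A.mulVec (vV k vk x) - x (i0 k) • vV k vk x

/-- The Newton-like operator `T(x) = x - R f(x)`. -/
def TT {n : ℕ} (A R : Matrix (Fin n) (Fin n) ℂ) (k : Fin n) (vk : ℂ) (x : Fin n → ℂ) :
    Fin n → ℂ :=
  x - R.mulVec (fE A k vk x)

/-- The Jacobian matrix of `f` at `x` (matrix of the Fréchet derivative in standard coords). -/
def jacF {n : ℕ} (A : Matrix (Fin n) (Fin n) ℂ) (k : Fin n) (vk : ℂ) (x : Fin n → ℂ) :
    Matrix (Fin n) (Fin n) ℂ :=
  fun i j => fderiv ℂ (fE A k vk) x (Pi.single j 1) i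

/-- The matrix `DT(x) = I - R · Df(x)`. -/
def DTm {n : ℕ} (A R : Matrix (Fin n) (Fin n) ℂ) (k : Fin n) (vk : ℂ) (x : Fin n → ℂ) :
    Matrix (Fin n) (Fin n) ℂ := 1 - R * jacF A k vk x

theorem vV_star {n : ℕ} (k : Fin n) (vk : ℂ) (x : Fin n → ℂ) :
    vV k (star vk) (star x) = star (vV k vk x) := by
  ext j
  simp only [vV, Pi.star_apply]
  split_ifs <;> rfl

theorem fE_star {n : ℕ} (A : Matrix (Fin n) (Fin n) ℂ) (k : Fin n) (vk : ℂ) (x : Fin n → ℂ) :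
    fE (A.map star) k (star vk) (star x) = star (fE A k vk x) := by
  rw [fE, vV_star]
  ext j
  simp [fE, Matrix.mulVec, dotProduct]

/-- if `A`, `v̄ₖ` and `x̄` are real and `f` has exactly one zero in `B̄(x̄, r)`,
then this zero has all real coordinates; in particular `λ(x) ∈ ℝ` and every component of
`v(x)` is real. -/
theorem stmt9 {n : ℕ} (hn : 2 ≤ n) (A : Matrix (Fin n) (Fin n) ℂ) (k : Fin n) (vk : ℂ)
    (xb : Fin n → ℂ) (hA : ∀ i j, (A i j).im = 0) (hvk : vk.im = 0)
    (hxb : ∀ i, (xb i).im = 0) (r : ℝ) (hr : 0 < r)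
    (huniq : ∃! x : Fin n → ℂ, x ∈ Metric.closedBall xb r ∧ fE A k vk x = 0) :
    ∀ x : Fin n → ℂ, x ∈ Metric.closedBall xb r → fE A k vk x = 0 →
      (∀ i, (x i).im = 0) ∧ (x (i0 k)).im = 0 ∧ ∀ j, (vV k vk x j).im = 0 := by
  have star_of_im_zero {z : ℂ} (hz : z.im = 0) : star z = z := Complex.conj_eq_iff_im.mpr hz
  intro x hx hfx
  have hA' : A.map star = A := by
    ext i j
    exact star_of_im_zero (hA i j)
  have hxb' : star xb = xb := funext fun i => star_of_im_zero (hxb i)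
  have hball : star x ∈ Metric.closedBall xb r := by
    rw [mem_closedBall_iff_norm] at hx ⊢
    rwa [← hxb', ← star_sub, norm_star]
  have hzero : fE A k vk (star x) = 0 := by
    have h := fE_star A k vk x
    rwa [hA', star_of_im_zero hvk, hfx, star_zero] at h
  have hstar : star x = x := huniq.unique ⟨hball, hzero⟩ ⟨hx, hfx⟩
  refine ⟨fun i => Complex.conj_eq_iff_im.mp (congrFun hstar i),
    Complex.conj_eq_iff_im.mp (congrFun hstar (i0 k)), fun j => ?_⟩
  have h := vV_star k vk x
  rw [star_of_im_zero hvk, hstar] at h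
  exact Complex.conj_eq_iff_im.mp (congrFun h j).symm
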